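/- Let k and a be positive integers. For every virtual knot K there exists a virtual knot K' such that K and K' are related by a finite sequence of 2k-moves and d_{2k}(K, K') = a. -/

import Mathlib

/-!
Combinatorial Gauss diagrams.

A Gauss diagram is encoded as a list of chord endpoints read along the
oriented circle from a basepoint.  Each endpoint records the (natural number)
label of its chord, whether it is the terminal endpoint of the (oriented)
chord, and the sign of the chord (`true` = +1, `false` = -1).
Diagrams are considered up to rotation of the basepoint and relabeling of the
chords; these renamings are included among the "Reidemeister" generators.
-/

structure Endpoint where
  label : ℕ
  isTerminal : Bool
  sign : Bool
deriving DecidableEq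

namespace Gauss

/-- The sign (±1) of the chord through an endpoint. -/
def signValue (e : Endpoint) : ℤ := if e.sign then 1 else -1

/-- The sign assigned to an endpoint: `ε` at the terminal endpoint and `-ε`
at the initial endpoint of a chord of sign `ε`. -/
def endpointValue (e : Endpoint) : ℤ := if e.isTerminal then signValue e else -signValue e

/-- The list of chord labels of the endpoints of a word. -/
def labels (L : List Endpoint) : List ℕ := L.map Endpoint.label

/-- A word is a Gauss diagram when every chord label occurring in it occurs
exactly twice, once as an initial and once as a terminal endpoint, with the
same sign at both occurrences. -/
def IsGaussDiagram (L : List Endpoint) : Prop :=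
  ∀ e ∈ L, (L.filter (fun x => x.label == e.label)).length = 2 ∧
    ∃ e' ∈ L, e'.label = e.label ∧ e'.isTerminal = !e.isTerminal ∧ e'.sign = e.sign

/-- Rotate a word so that the first endpoint satisfying `p` comes first. -/
def rotateTo (L : List Endpoint) (p : Endpoint → Bool) : List Endpoint :=
  match L.findIdx? p with
  | some i => L.drop i ++ L.take i
  | none => L

/-- The index of the chord labeled `c`: the sum of the signs assigned to the
endpoints on the arc running from the initial endpoint of the chord to its
terminal endpoint in the direction of the circle's orientation. -/
def chordIndex (L : List Endpoint) (c : ℕ) : ℤ :=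
  ((((rotateTo L (fun e => e.label == c && !e.isTerminal)).drop 1).takeWhile
      (fun e => e.label != c)).map endpointValue).sum

/-- `Jn L n`: the sum of the signs of the chords of `L` of index `n`. -/
def Jn (L : List Endpoint) (n : ℤ) : ℤ :=
  ((L.filter (fun e => e.isTerminal && decide (chordIndex L e.label = n))).map signValue).sum

/-- The odd writhe: the sum of the signs of the chords of odd index,
i.e. `J = Σ_{n odd} J_n`. -/
def oddWrithe (L : List Endpoint) : ℤ :=
  ((L.filter (fun e => e.isTerminal && decide (chordIndex L e.label % 2 ≠ 0))).map signValue).sum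

/-- Moving the basepoint of the circle. -/
def rotateStep (L L' : List Endpoint) : Prop :=
  ∃ x xs, L = x :: xs ∧ L' = xs ++ [x]

/-- Injective relabeling of the chords. -/
def relabelStep (L L' : List Endpoint) : Prop :=
  ∃ f : ℕ → ℕ, Function.Injective f ∧
    L' = L.map (fun e => Endpoint.mk (f e.label) e.isTerminal e.sign)

/-- Reidemeister move I (removal direction): remove an isolated chord whose
two endpoints are adjacent (either orientation, either sign). -/
def reid1 (L L' : List Endpoint) : Prop :=
  ∃ (A B : List Endpoint) (c : ℕ) (t s : Bool),
    c ∉ labels (A ++ B) ∧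
    L = A ++ [Endpoint.mk c t s, Endpoint.mk c (!t) s] ++ B ∧
    L' = A ++ B

/-- Reidemeister move II (removal direction): remove two chords of opposite
signs whose initial endpoints are adjacent and whose terminal endpoints are
adjacent (in either of the two admissible orders). -/
def reid2 (L L' : List Endpoint) : Prop :=
  ∃ (A B C : List Endpoint) (c d : ℕ) (s crossed : Bool),
    c ≠ d ∧ c ∉ labels (A ++ B ++ C) ∧ d ∉ labels (A ++ B ++ C) ∧
    L = A ++ [Endpoint.mk c false s, Endpoint.mk d false (!s)] ++ B ++
        (if crossed then [Endpoint.mk c true s, Endpoint.mk d true (!s)]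
         else [Endpoint.mk d true (!s), Endpoint.mk c true s]) ++ C ∧
    L' = A ++ B ++ C

/-- Reidemeister move III (a standard variant; together with the moves I, II,
rotations and relabelings it generates all versions of the third move). -/
def reid3 (L L' : List Endpoint) : Prop :=
  ∃ (A B C D : List Endpoint) (a b c : ℕ) (s : Bool),
    a ≠ b ∧ b ≠ c ∧ a ≠ c ∧
    L = A ++ [Endpoint.mk b false s, Endpoint.mk a false s] ++ B ++
        [Endpoint.mk a true s, Endpoint.mk c false (!s)] ++ C ++
        [Endpoint.mk b true s, Endpoint.mk c true (!s)] ++ D ∧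
    L' = A ++ [Endpoint.mk a false s, Endpoint.mk b false s] ++ B ++
        [Endpoint.mk c false (!s), Endpoint.mk a true s] ++ C ++
        [Endpoint.mk c true (!s), Endpoint.mk b true s] ++ D

/-- A single Reidemeister generator (including diagram renamings). -/
def reidStep (L L' : List Endpoint) : Prop :=
  rotateStep L L' ∨ relabelStep L L' ∨ reid1 L L' ∨ reid2 L L' ∨ reid3 L L'

/-- A Ξ-move: exchange the first and third of three consecutive endpoints
belonging to three distinct chords, keeping all signs and orientations. -/
def xiStep (L L' : List Endpoint) : Prop :=
  ∃ (A B : List Endpoint) (x y z : Endpoint),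
    x.label ≠ y.label ∧ y.label ≠ z.label ∧ x.label ≠ z.label ∧
    L = A ++ [x, y, z] ++ B ∧
    L' = A ++ [z, y, x] ++ B

/-- A 2k-move (removal direction): remove `2k` chords `c 0, …, c (2k-1)`, all
of sign `s`, whose `p`-endpoints appear consecutively on one arc and whose
`q`-endpoints appear consecutively on a disjoint arc, the chord `c i` being
oriented from `p` to `q` for even `i` (the paper's odd `i`, 1-indexed) and
from `q` to `p` for odd `i`, so initial and terminal endpoints alternate. -/
def move2k (k : ℕ) (L L' : List Endpoint) : Prop :=
  ∃ (A B C : List Endpoint) (c : ℕ → ℕ) (s : Bool),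
    (∀ i < 2 * k, ∀ j < 2 * k, c i = c j → i = j) ∧
    (∀ i < 2 * k, c i ∉ labels (A ++ B ++ C)) ∧
    L = A ++ (List.range (2 * k)).map (fun i => Endpoint.mk (c i) (decide (i % 2 = 1)) s)
          ++ B ++
        (List.range (2 * k)).map (fun i => Endpoint.mk (c i) (decide (i % 2 = 0)) s)
          ++ C ∧
    L' = A ++ B ++ C

/-- A crossing change: reverse the sign and the orientation of one chord. -/
def crossingChange (L L' : List Endpoint) : Prop :=
  ∃ c : ℕ,
    L' = L.map (fun e =>
      if e.label = c then Endpoint.mk e.label (!e.isTerminal) (!e.sign) else e)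

/-- Finite sequences of moves from `r`, performed in either direction. -/
def Moves (r : List Endpoint → List Endpoint → Prop) :
    List Endpoint → List Endpoint → Prop :=
  Relation.ReflTransGen (fun L L' => r L L' ∨ r L' L)

/-- Related by Reidemeister moves: the two words represent the same virtual knot. -/
def ReidEquiv : List Endpoint → List Endpoint → Prop := Moves reidStep

/-- Related by a finite sequence of 2k-moves (and Reidemeister moves). -/
def Rel2k (k : ℕ) : List Endpoint → List Endpoint → Prop :=
  Moves (fun L L' => reidStep L L' ∨ move2k k L L')

/-- Related by a finite sequence of Ξ-moves (and Reidemeister moves). -/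
def RelXi : List Endpoint → List Endpoint → Prop :=
  Moves (fun L L' => reidStep L L' ∨ xiStep L L')

/-- Related by a finite sequence of 2k-moves and Ξ-moves (and Reidemeister moves). -/
def Rel2kXi (k : ℕ) : List Endpoint → List Endpoint → Prop :=
  Moves (fun L L' => reidStep L L' ∨ move2k k L L' ∨ xiStep L L')

/-- Related by a finite sequence of crossing changes and Ξ-moves
(and Reidemeister moves). -/
def RelCCXi : List Endpoint → List Endpoint → Prop :=
  Moves (fun L L' => reidStep L L' ∨ crossingChange L L' ∨ xiStep L L')

/-- A shell-pair of sign `s`: two chords `c`, `d` of sign `s` whose four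
endpoints are consecutive, interleaved as 1st-3rd and 2nd-4th
(with arbitrary orientations `t`, `u` of the two shells). -/
def shellPair (c d : ℕ) (t u s : Bool) : List Endpoint :=
  [Endpoint.mk c t s, Endpoint.mk d u s, Endpoint.mk c (!t) s, Endpoint.mk d (!u) s]

/-- The Gauss diagram `G(a)`: `|a|` consecutive shell-pairs of sign `+1` if
`a > 0` and of sign `-1` if `a < 0`; `G(0)` has no chords.  It represents the
virtual knot `K(a)`. -/
def Gword (a : ℤ) : List Endpoint :=
  ((List.range a.natAbs).map
    (fun j => shellPair (2 * j) (2 * j + 1) false false (decide (0 < a)))).flatten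

/-- `Rel2kCount k m G G'`: `G` and `G'` are related by a finite sequence of
Reidemeister moves and exactly `m` 2k-moves. -/
inductive Rel2kCount (k : ℕ) : ℕ → List Endpoint → List Endpoint → Prop
  | refl (L : List Endpoint) : Rel2kCount k 0 L L
  | reid {m : ℕ} {L L' L'' : List Endpoint} :
      reidStep L L' ∨ reidStep L' L →
      Rel2kCount k m L' L'' → Rel2kCount k m L L''
  | move {m : ℕ} {L L' L'' : List Endpoint} :
      move2k k L L' ∨ move2k k L' L →
      Rel2kCount k m L' L'' → Rel2kCount k (m + 1) L L''

/-- The 2k-move distance: the minimal number of 2k-moves needed to relate the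
two diagrams (together with Reidemeister moves). -/
noncomputable def dist2k (k : ℕ) (L L' : List Endpoint) : ℕ :=
  sInf {m | Rel2kCount k m L L'}

end Gauss

namespace Gauss

/-- Alternating sum of `v` over the occurrences of the label `c`. -/
def alt (c : ℕ) (v : Bool → ℤ) : List Endpoint → ℤ
  | [] => 0
  | x :: xs => (if x.label = c then v x.sign else 0) - alt c v xs

def sv (b : Bool) : ℤ := if b then 1 else -1

/-- Contribution of the chord `c` (four times its sign if it is odd, otherwise zero). -/
def gw (L : List Endpoint) (c : ℕ) : ℤ := alt c (fun _ => 1) L * alt c sv L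

/-- Four times the odd writhe. -/
def FW (L : List Endpoint) : ℤ := ∑ c ∈ (labels L).toFinset, gw L c

theorem alt_append (c : ℕ) (v : Bool → ℤ) (A B : List Endpoint) :
    alt c v (A ++ B) = alt c v A + (-1) ^ A.length * alt c v B := by
  induction A with
  | nil => simp [alt]
  | cons x xs ih => simp only [List.cons_append, alt, ih, List.length_cons, pow_succ]; ring

theorem alt_zero (c : ℕ) (v : Bool → ℤ) (A : List Endpoint) (h : c ∉ labels A) :
    alt c v A = 0 := by
  induction A with
  | nil => simp [alt]
  | cons x xs ih =>
    simp only [labels, List.map_cons, List.mem_cons, not_or] at h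
    have h1 : ¬ x.label = c := fun e => h.1 e.symm
    simp [alt, h1, ih h.2]

theorem labels_append (A B : List Endpoint) : labels (A ++ B) = labels A ++ labels B := by
  simp [labels]

theorem labels_cons (x : Endpoint) (B : List Endpoint) :
    labels (x :: B) = x.label :: labels B := by
  simp [labels]

theorem labels_nil : labels [] = [] := rfl

def Good (L : List Endpoint) : Prop := ∀ c, (labels L).count c = 0 ∨ (labels L).count c = 2

theorem Good.even {L : List Endpoint} (h : Good L) : Even L.length := by
  have h1 : ∑ c ∈ (labels L).toFinset, (labels L).count c = (labels L).length :=
    List.sum_toFinset_count_eq_length (labels L)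
  have h2 : (labels L).length = L.length := by simp [labels]
  rw [← h2, ← h1]
  apply Finset.even_sum
  intro c _
  rcases h c with h | h <;> rw [h] <;> decide

theorem FW_insert (N : Finset ℕ) (L L' : List Endpoint)
    (hd : ∀ x ∈ N, x ∉ labels L')
    (hl : (labels L).toFinset = N ∪ (labels L').toFinset)
    (hg : ∀ x ∉ N, gw L x = gw L' x) : FW L = ∑ x ∈ N, gw L x + FW L' := by
  unfold FW
  rw [hl, Finset.sum_union]
  · congr 1
    apply Finset.sum_congr rfl
    intro x hx
    apply hg
    intro hN
    exact hd x hN (by simpa using hx)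
  · rw [Finset.disjoint_left]
    intro x hx
    simpa using hd x hx

theorem FW_same (L L' : List Endpoint)
    (hl : ∀ x, x ∈ labels L ↔ x ∈ labels L')
    (hg : ∀ x, gw L x = gw L' x) : FW L = FW L' := by
  have := FW_insert ∅ L L' (by simp) (by ext x; simpa using hl x) (by simpa using hg)
  simpa using this

theorem neg_one_pow_sq' (n : ℕ) : ((-1 : ℤ) ^ n) * (-1) ^ n = 1 := by
  rw [← mul_pow]; simp

theorem FW_rotate {L L' : List Endpoint} (h : rotateStep L L') (hL : Even L.length) :
    FW L = FW L' := by
  obtain ⟨x, xs, rfl, rfl⟩ := h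
  have ho : Odd xs.length := by
    rw [List.length_cons] at hL
    rcases Nat.even_or_odd xs.length with h | h
    · exact absurd hL (by rw [Nat.not_even_iff_odd]; exact h.add_one)
    · exact h
  apply FW_same
  · intro y; simp [labels_append, labels_cons, labels_nil, or_comm]
  · intro y
    simp only [gw, alt_append, alt, ho.neg_one_pow]
    ring

theorem alt_relabel (f : ℕ → ℕ) (hf : Function.Injective f) (c : ℕ) (v : Bool → ℤ)
    (L : List Endpoint) :
    alt (f c) v (L.map (fun e => Endpoint.mk (f e.label) e.isTerminal e.sign)) = alt c v L := by
  induction L with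
  | nil => simp [alt]
  | cons x xs ih => simp [alt, ih, hf.eq_iff]

theorem labels_relabel (f : ℕ → ℕ) (L : List Endpoint) :
    labels (L.map (fun e => Endpoint.mk (f e.label) e.isTerminal e.sign)) = (labels L).map f := by
  simp [labels]

theorem FW_relabel {L L' : List Endpoint} (h : relabelStep L L') : FW L = FW L' := by
  obtain ⟨f, hf, rfl⟩ := h
  unfold FW
  rw [labels_relabel]
  have : ((labels L).map f).toFinset = (labels L).toFinset.image f := by
    ext; simp
  rw [this, Finset.sum_image (fun _ _ _ _ h => hf h)]
  apply Finset.sum_congr rfl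
  intro c _
  simp [gw, alt_relabel f hf]

theorem FW_reid1 {L L' : List Endpoint} (h : reid1 L L') : FW L = FW L' := by
  obtain ⟨A, B, c, t, s, hc, rfl, rfl⟩ := h
  have := FW_insert {c} (A ++ [Endpoint.mk c t s, Endpoint.mk c (!t) s] ++ B) (A ++ B)
    (by simpa using hc)
    (by ext x; simp [labels_append, labels_cons, labels_nil]; try tauto)
    (by
      intro x hx
      have hx' : ¬ c = x := fun e => hx (by simp [e])
      simp [gw, alt_append, alt, hx', pow_add])
  rw [this]
  simp only [labels_append, List.mem_append, not_or] at hc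
  simp [gw, alt_append, alt, alt_zero c _ A hc.1, alt_zero c _ B hc.2]

theorem FW_reid2 {L L' : List Endpoint} (h : reid2 L L') : FW L = FW L' := by
  obtain ⟨A, B, C, c, d, s, cr, hcd, hc, hd, hL, rfl⟩ := h
  have := FW_insert {c, d} L (A ++ B ++ C)
    (by rintro x hx; simp only [Finset.mem_insert, Finset.mem_singleton] at hx; rcases hx with rfl | rfl <;> assumption)
    (by subst hL; ext x; cases cr <;> simp [labels_append, labels_cons, labels_nil] <;> tauto)
    (by
      intro x hx
      have hx1 : ¬ c = x := fun e => hx (by simp [e])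
      have hx2 : ¬ d = x := fun e => hx (by simp [e])
      subst hL
      cases cr <;> simp [gw, alt_append, alt, hx1, hx2, pow_add])
  rw [this, Finset.sum_pair hcd]
  simp only [labels_append, List.mem_append, not_or] at hc hd
  have hdc : ¬ d = c := fun e => hcd e.symm
  subst hL
  cases cr <;> cases s <;> simp [gw, alt_append, alt, alt_zero c _ A hc.1.1, alt_zero c _ B hc.1.2,
    alt_zero c _ C hc.2, alt_zero d _ A hd.1.1, alt_zero d _ B hd.1.2,
    alt_zero d _ C hd.2, hcd, hdc, sv, pow_add] <;> ring

theorem FW_reid3 {L L' : List Endpoint} (h : reid3 L L') (hL : Good L) : FW L = FW L' := by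
  obtain ⟨A, B, C, D, a, b, c, s, hab, hbc, hac, rfl, rfl⟩ := h
  have hba : ¬ b = a := fun e => hab e.symm
  have hcb : ¬ c = b := fun e => hbc e.symm
  have hca : ¬ c = a := fun e => hac e.symm
  have key : ∀ x, x = a ∨ x = b ∨ x = c →
      x ∉ labels A ∧ x ∉ labels B ∧ x ∉ labels C ∧ x ∉ labels D := by
    intro x hx
    have := hL x
    simp only [← List.count_eq_zero]
    rcases hx with rfl | rfl | rfl <;>
    simp [labels_append, labels_cons, labels_nil, List.count_cons, hab, hbc, hac, hba, hcb, hca]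
      at this <;> omega
  apply FW_same
  · intro x; simp [labels_append, labels_cons, labels_nil]; tauto
  · intro x
    by_cases hx : x = a ∨ x = b ∨ x = c
    · obtain ⟨hA, hB, hC, hD⟩ := key x hx
      simp only [gw, alt_append, alt_zero x _ A hA, alt_zero x _ B hB,
        alt_zero x _ C hC, alt_zero x _ D hD]
      rcases hx with rfl | rfl | rfl <;>
      simp [alt, hab, hbc, hac, hba, hcb, hca, pow_add] <;> ring
    · push Not at hx
      obtain ⟨h1, h2, h3⟩ := hx
      simp [gw, alt_append, alt, h1.symm, h2.symm, h3.symm, pow_add]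

/-- A block of `n` endpoints. -/
def blk (c : ℕ → ℕ) (q : ℕ → Bool) (s : Bool) (n : ℕ) : List Endpoint :=
  (List.range n).map (fun i => Endpoint.mk (c i) (q i) s)

theorem labels_blk (c : ℕ → ℕ) (q : ℕ → Bool) (s : Bool) (n : ℕ) :
    labels (blk c q s n) = (List.range n).map c := by
  simp [labels, blk, Function.comp_def]

theorem blk_length (c : ℕ → ℕ) (q : ℕ → Bool) (s : Bool) (n : ℕ) :
    (blk c q s n).length = n := by simp [blk]

theorem alt_blk (c : ℕ → ℕ) (q : ℕ → Bool) (s : Bool) (v : Bool → ℤ) (n : ℕ)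
    (hc : ∀ i < n, ∀ j < n, c i = c j → i = j) (i : ℕ) (hi : i < n) :
    alt (c i) v (blk c q s n) = (-1) ^ i * v s := by
  induction n with
  | zero => omega
  | succ n ih =>
    have : blk c q s (n + 1) = blk c q s n ++ [Endpoint.mk (c n) (q n) s] := by
      simp [blk, List.range_succ]
    rw [this, alt_append, blk_length]
    rcases Nat.lt_succ_iff_lt_or_eq.mp hi with h | rfl
    · rw [ih (fun i hi j hj => hc i (by omega) j (by omega)) h]
      have : ¬ c n = c i := fun e => by
        have := hc n (by omega) i (by omega) e; omega
      simp [alt, this]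
    · rw [alt_zero]
      · simp [alt]
      · rw [labels_blk]
        simp only [List.mem_map, List.mem_range, not_exists, not_and]
        intro j hj e
        have := hc j (by omega) i (by omega) e; omega

theorem FW_move {k : ℕ} {A B C : List Endpoint} {c : ℕ → ℕ} {s : Bool} (q r : ℕ → Bool)
    (hc : ∀ i < 2 * k, ∀ j < 2 * k, c i = c j → i = j)
    (hn : ∀ i < 2 * k, c i ∉ labels (A ++ B ++ C)) :
    FW (A ++ blk c q s (2 * k) ++ B ++ blk c r s (2 * k) ++ C) =
      2 * k * sv s * (1 + (-1) ^ B.length) ^ 2 + FW (A ++ B ++ C) := by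
  rw [FW_insert ((Finset.range (2 * k)).image c) _ (A ++ B ++ C)]
  · congr 1
    rw [Finset.sum_image (fun i hi j hj h => hc i (by simpa using hi) j (by simpa using hj) h)]
    rw [Finset.sum_congr rfl (g := fun _ => sv s * (1 + (-1) ^ B.length) ^ 2)]
    · simp; ring
    · intro i hi
      rw [Finset.mem_range] at hi
      have h := hn i hi
      simp only [labels_append, List.mem_append, not_or] at h
      simp only [gw, alt_append, alt_zero _ _ A h.1.1, alt_zero _ _ B h.1.2,
        alt_zero _ _ C h.2, alt_blk c _ s _ _ hc i hi, List.length_append, blk_length, pow_add,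
        pow_mul]
      have h1 := neg_one_pow_sq' A.length
      have h2 := neg_one_pow_sq' i
      generalize (-1 : ℤ) ^ A.length = x at *
      generalize (-1 : ℤ) ^ B.length = y at *
      generalize (-1 : ℤ) ^ i = z at *
      norm_num
      linear_combination (z * z * sv s * (1 + y) ^ 2) * h1 + (sv s * (1 + y) ^ 2) * h2
  · intro x hx
    simp only [Finset.mem_image, Finset.mem_range] at hx
    obtain ⟨i, hi, rfl⟩ := hx
    exact hn i hi
  · ext x
    simp [labels_append, labels_blk]
    generalize (∃ a < 2 * k, c a = x) = P
    tauto
  · intro x hx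
    have h1 : ∀ q, x ∉ labels (blk c q s (2 * k)) := by
      intro q
      rw [labels_blk]
      simpa using hx
    simp [gw, alt_append, alt_zero _ _ _ (h1 _), blk_length, pow_add, pow_mul]

theorem count_blk_le (c : ℕ → ℕ) (q : ℕ → Bool) (s : Bool) (n : ℕ)
    (hc : ∀ i < n, ∀ j < n, c i = c j → i = j) (x : ℕ) :
    (labels (blk c q s n)).count x = if ∃ i < n, c i = x then 1 else 0 := by
  rw [labels_blk]
  have hnd : ((List.range n).map c).Nodup :=
    List.Nodup.map_on (fun i hi j hj h =>
      hc i (by simpa using hi) j (by simpa using hj) h) List.nodup_range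
  rw [hnd.count]
  simp

theorem move_blk {k : ℕ} {L L' : List Endpoint} (h : move2k k L L') :
    ∃ (A B C : List Endpoint) (c : ℕ → ℕ) (s : Bool) (q r : ℕ → Bool),
    (∀ i < 2 * k, ∀ j < 2 * k, c i = c j → i = j) ∧
    (∀ i < 2 * k, c i ∉ labels (A ++ B ++ C)) ∧
    L = A ++ blk c q s (2 * k) ++ B ++ blk c r s (2 * k) ++ C ∧ L' = A ++ B ++ C := by
  obtain ⟨A, B, C, c, s, h1, h2, h3, h4⟩ := h
  exact ⟨A, B, C, c, s, _, _, h1, h2, h3, h4⟩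

theorem good_move {k : ℕ} {L L' : List Endpoint} (h : move2k k L L') : Good L ↔ Good L' := by
  obtain ⟨A, B, C, c, s, q, r, hc, hn, rfl, rfl⟩ := move_blk h
  apply forall_congr'
  intro x
  simp only [labels_append, List.count_append, count_blk_le c _ s _ hc]
  split_ifs with hx
  · obtain ⟨i, hi, rfl⟩ := hx
    have := hn i hi
    rw [← List.count_eq_zero] at this
    simp only [labels_append, List.count_append] at this
    omega
  · simp

theorem FW_move_le {k : ℕ} {L L' : List Endpoint} (h : move2k k L L') :
    |FW L - FW L'| ≤ 8 * k := by
  obtain ⟨A, B, C, c, s, q, r, hc, hn, rfl, rfl⟩ := move_blk h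
  rw [FW_move q r hc hn, add_sub_cancel_right]
  rcases neg_one_pow_eq_or ℤ B.length with h | h <;> rw [h] <;> cases s <;>
    simp [sv] <;> linarith

theorem good_reid {L L' : List Endpoint} (h : reidStep L L') : Good L ↔ Good L' := by
  rcases h with h | h | h | h | h
  · obtain ⟨x, xs, rfl, rfl⟩ := h
    apply forall_congr'
    intro y
    simp [labels_append, labels_cons, labels_nil, List.count_cons]
  · obtain ⟨f, hf, rfl⟩ := h
    unfold Good
    rw [labels_relabel]
    constructor
    · intro h y
      by_cases hy : y ∈ (labels L).map f
      · obtain ⟨z, _, rfl⟩ := List.mem_map.mp hy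
        rw [List.count_map_of_injective _ _ hf]
        exact h z
      · left; exact List.count_eq_zero.mpr hy
    · intro h y
      have := h (f y)
      rwa [List.count_map_of_injective _ _ hf] at this
  · obtain ⟨A, B, c, t, s, hc, rfl, rfl⟩ := h
    apply forall_congr'
    intro x
    rw [← List.count_eq_zero] at hc
    simp only [labels_append, labels_cons, labels_nil, List.count_append, List.count_cons,
      List.count_nil, beq_iff_eq] at hc ⊢
    split_ifs with h
    · subst h; omega
    · simp
  · obtain ⟨A, B, C, c, d, s, cr, hcd, hc, hd, rfl, rfl⟩ := h
    apply forall_congr'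
    intro x
    rw [← List.count_eq_zero] at hc hd
    cases cr <;>
    simp only [labels_append, labels_cons, labels_nil, List.count_append, List.count_cons,
      List.count_nil, beq_iff_eq, if_true, Bool.false_eq_true, if_false] at hc hd ⊢ <;>
    (by_cases h1 : c = x
     · subst h1
       simp only [if_true, if_neg (Ne.symm hcd)]; omega
     · by_cases h2 : d = x
       · subst h2; simp only [if_true, if_neg h1]; omega
       · simp [h1, h2])
  · obtain ⟨A, B, C, D, a, b, c, s, hab, hbc, hac, rfl, rfl⟩ := h
    apply forall_congr'
    intro x
    simp only [labels_append, labels_cons, labels_nil, List.count_append, List.count_cons,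
      List.count_nil]
    constructor <;> intro h <;> omega

theorem FW_reid {L L' : List Endpoint} (h : reidStep L L') (hL : Good L) : FW L = FW L' := by
  rcases h with h | h | h | h | h
  · exact FW_rotate h hL.even
  · exact FW_relabel h
  · exact FW_reid1 h
  · exact FW_reid2 h
  · exact FW_reid3 h hL

theorem FW_bound {k m : ℕ} {L L' : List Endpoint} (h : Rel2kCount k m L L') (hL : Good L) :
    |FW L - FW L'| ≤ 8 * k * m := by
  induction h with
  | refl L => simp
  | reid h _ ih =>
    rcases h with h | h
    · rw [FW_reid h hL]; exact ih ((good_reid h).mp hL)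
    · have hL' := (good_reid h).mpr hL
      rw [← FW_reid h hL']; exact ih hL'
  | @move m L L' L'' h _ ih =>
    have h1 : |FW L - FW L'| ≤ 8 * k := by
      rcases h with h | h
      · exact FW_move_le h
      · rw [abs_sub_comm]; exact FW_move_le h
    have hL' : Good L' := by
      rcases h with h | h
      · exact (good_move h).mp hL
      · exact (good_move h).mpr hL
    have h2 := ih hL'
    have h3 := abs_sub_le (FW L) (FW L') (FW L'')
    push_cast
    linarith

theorem count_labels (L : List Endpoint) (c : ℕ) :
    (L.filter (fun x => x.label == c)).length = (labels L).count c := by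
  induction L with
  | nil => simp [labels]
  | cons x xs ih =>
    rw [labels_cons, List.count_cons, ← ih, List.filter_cons]
    split_ifs <;> simp

theorem good_of_gauss {L : List Endpoint} (h : IsGaussDiagram L) : Good L := by
  intro c
  by_cases hc : c ∈ labels L
  · right
    obtain ⟨e, he, rfl⟩ := List.mem_map.mp hc
    rw [← count_labels]
    exact (h e he).1
  · left; exact List.count_eq_zero.mpr hc

theorem exists_step (k : ℕ) (L : List Endpoint) (hL : IsGaussDiagram L) :
    ∃ L', IsGaussDiagram L' ∧ move2k k L' L ∧ FW L' = FW L + 8 * k := by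
  obtain ⟨N, hN⟩ : ∃ N, ∀ x ∈ labels L, x < N :=
    ⟨(labels L).toFinset.sup id + 1, fun x hx =>
      Nat.lt_succ_of_le (Finset.le_sup (f := id) (by simpa using hx))⟩
  have hc : ∀ i < 2 * k, ∀ j < 2 * k, (fun i => N + i) i = (fun i => N + i) j → i = j := by
    intro i _ j _ h; simpa using h
  have hn : ∀ i < 2 * k, (fun i => N + i) i ∉ labels (L ++ [] ++ []) := by
    intro i _ h
    have := hN _ (by simpa using h)
    simp at this
  have hm : move2k k (L ++ blk (fun i => N + i) (fun i => decide (i % 2 = 1)) true (2 * k) ++ [] ++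
      blk (fun i => N + i) (fun i => decide (i % 2 = 0)) true (2 * k) ++ []) L :=
    ⟨L, [], [], fun i => N + i, true, hc, hn, rfl, by simp⟩
  refine ⟨_, ?_, hm, ?_⟩
  · have hg := (good_move hm).mpr (good_of_gauss hL)
    intro e he
    constructor
    · rw [count_labels]
      rcases hg e.label with h | h
      · rw [List.count_eq_zero] at h
        exact absurd (List.mem_map_of_mem he) h
      · exact h
    · simp only [List.append_nil, List.mem_append] at he ⊢
      rcases he with (he | he) | he
      · obtain ⟨-, e', h1, h2⟩ := hL e he
        exact ⟨e', Or.inl (Or.inl h1), h2⟩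
      · obtain ⟨i, hi, rfl⟩ := List.mem_map.mp he
        refine ⟨_, Or.inr (List.mem_map.mpr ⟨i, hi, rfl⟩), rfl, ?_, rfl⟩
        rcases Nat.mod_two_eq_zero_or_one i with h | h <;> simp [h]
      · obtain ⟨i, hi, rfl⟩ := List.mem_map.mp he
        refine ⟨_, Or.inl (Or.inr (List.mem_map.mpr ⟨i, hi, rfl⟩)), rfl, ?_, rfl⟩
        rcases Nat.mod_two_eq_zero_or_one i with h | h <;> simp [h]
  · rw [FW_move _ _ hc hn]
    simp [sv]; ring

theorem exists_steps (k a : ℕ) : ∀ (L : List Endpoint), IsGaussDiagram L →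
    ∃ L', IsGaussDiagram L' ∧ Rel2kCount k a L L' ∧ FW L' = FW L + 8 * k * a := by
  induction a with
  | zero => intro L hL; exact ⟨L, hL, .refl L, by simp⟩
  | succ a ih =>
    intro L hL
    obtain ⟨L1, h1, h2, h3⟩ := exists_step k L hL
    obtain ⟨L2, h4, h5, h6⟩ := ih L1 h1
    refine ⟨L2, h4, .move (Or.inr h2) h5, ?_⟩
    rw [h6, h3]; push_cast; ring

end Gauss

open Gauss in
/-- for every virtual knot `K` and positive integers `k`, `a`
there is a virtual knot `K'` with `d_{2k}(K, K') = a`. -/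
theorem exists_dist2k_eq (k a : ℕ) (hk : 0 < k) (ha : 0 < a)
    (G : List Endpoint) (hG : IsGaussDiagram G) :
    ∃ G' : List Endpoint, IsGaussDiagram G' ∧
      (∃ m : ℕ, Rel2kCount k m G G') ∧ dist2k k G G' = a := by
  obtain ⟨G', h1, h2, h3⟩ := exists_steps k a G hG
  refine ⟨G', h1, ⟨a, h2⟩, le_antisymm (Nat.sInf_le h2) ?_⟩
  have hm : Rel2kCount k (dist2k k G G') G G' :=
    Nat.sInf_mem (s := {m | Rel2kCount k m G G'}) ⟨a, h2⟩
  have hb := FW_bound hm (good_of_gauss hG)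
  rw [h3, abs_sub_comm, add_sub_cancel_left, abs_of_nonneg (by positivity)] at hb
  have hk' : (0 : ℤ) < 8 * k := by positivity
  exact_mod_cast le_of_mul_le_mul_left hb hk'
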